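/- Changes of breakdown and repair mechanisms: for all square-summable f, g : Ẽ → ℝ, ⟨f, Q^Z g⟩_π̃ − ⟨f, Q^{Z′} g⟩_π̃ = Σ_{n∈ℕ^{J̃}} π(n) Σ_{D⊆J̃} π̂(D) f(D,n)·((Q^Y − Q^{Y′}) g(·,n))(D), where g(·,n) : 2^{J̃} → ℝ is the map D ↦ g(D,n). -/

import Mathlib

open scoped BigOperators

noncomputable section

namespace UnrelNet

/-- State space of the unreliable Jackson network: a set of broken-down nodes
together with a queue-length vector. -/
abbrev Est (J : ℕ) := Finset (Fin J) × (Fin J → ℕ)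

/-- The extended node set `J̃₀ ∖ D`: the exterior node `none` together with
the up nodes (complement of `D`). -/
def ext (J : ℕ) (D : Finset (Fin J)) : Finset (Option (Fin J)) :=
  insert none (Dᶜ.image Option.some)

/-- Unit vector `e_j` of `ℕ^J̃`, with `e_0 = 0` (index `none`). -/
def eV {J : ℕ} (o : Option (Fin J)) : Fin J → ℕ := fun i =>
  match o with
  | none => 0
  | some j => if i = j then 1 else 0

/-- Breakdown/repair generator `Q^Y`. -/
def QY {J : ℕ} (A B : Finset (Fin J) → ℝ) (f : Finset (Fin J) → ℝ)
    (D : Finset (Fin J)) : ℝ :=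
  (∑ H ∈ Finset.univ.filter (fun H => H ⊂ D), B D / B H * (f H - f D))
    + ∑ I ∈ Finset.univ.filter (fun I => D ⊂ I), A I / A D * (f I - f D)

/-- Off-diagonal breakdown/repair rates. -/
def qY0 {J : ℕ} (A B : Finset (Fin J) → ℝ) (D E : Finset (Fin J)) : ℝ :=
  if D ⊂ E then A E / A D else if E ⊂ D then B D / B E else 0

/-- Breakdown/repair rate matrix `q^Y`, including the diagonal. -/
def qY {J : ℕ} (A B : Finset (Fin J) → ℝ) (D E : Finset (Fin J)) : ℝ :=
  if E = D then -∑ F, qY0 A B D F else qY0 A B D E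

/-- Breakdown/repair generator written via the rate matrix. -/
def QYm {J : ℕ} (A B : Finset (Fin J) → ℝ) (f : Finset (Fin J) → ℝ)
    (D : Finset (Fin J)) : ℝ :=
  ∑ E, qY A B D E * f E

/-- Normalisation constant `Ĉ`. -/
def Chat {J : ℕ} (A B : Finset (Fin J) → ℝ) : ℝ := ∑ D, A D / B D

/-- Stationary distribution `π̂` of the breakdown/repair process. -/
def piY {J : ℕ} (A B : Finset (Fin J) → ℝ) (D : Finset (Fin J)) : ℝ :=
  (A D / B D) / Chat A B

/-- `Π_{i=1}^{k} η_j/μ_j(i)`. -/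
def prodK {J : ℕ} (η : Fin J → ℝ) (μ : Fin J → ℕ → ℝ) (j : Fin J) (k : ℕ) : ℝ :=
  ∏ i ∈ Finset.range k, η j / μ j (i + 1)

/-- Normalisation constant `C_j`. -/
def Cnorm {J : ℕ} (η : Fin J → ℝ) (μ : Fin J → ℕ → ℝ) (j : Fin J) : ℝ :=
  ∑' k : ℕ, prodK η μ j k

/-- Product-form stationary distribution `π` of the Jackson network. -/
def piX {J : ℕ} (η : Fin J → ℝ) (μ : Fin J → ℕ → ℝ) (n : Fin J → ℕ) : ℝ :=
  ∏ j, prodK η μ j (n j) / Cnorm η μ j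

/-- Product measure `π̃(D,n) = π̂(D)·π(n)`. -/
def piZ {J : ℕ} (η : Fin J → ℝ) (μ : Fin J → ℕ → ℝ) (A B : Finset (Fin J) → ℝ)
    (x : Est J) : ℝ :=
  piY A B x.1 * piX η μ x.2

/-- Generator `Q^Z` of the unreliable Jackson network. -/
def QZ {J : ℕ} (lam : ℝ) (μ : Fin J → ℕ → ℝ)
    (r : Finset (Fin J) → Option (Fin J) → Option (Fin J) → ℝ)
    (A B : Finset (Fin J) → ℝ) (f : Est J → ℝ) (x : Est J) : ℝ :=
  (∑ j ∈ x.1ᶜ, lam * r x.1 none (some j) * (f (x.1, x.2 + eV (some j)) - f x))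
    + (∑ j ∈ x.1ᶜ, μ j (x.2 j) * r x.1 (some j) none * (f (x.1, x.2 - eV (some j)) - f x))
    + (∑ j ∈ x.1ᶜ, ∑ i ∈ x.1ᶜ,
        μ j (x.2 j) * r x.1 (some j) (some i) * (f (x.1, x.2 - eV (some j) + eV (some i)) - f x))
    + (∑ H ∈ Finset.univ.filter (fun H => H ⊂ x.1), B x.1 / B H * (f (H, x.2) - f x))
    + ∑ I ∈ Finset.univ.filter (fun I => x.1 ⊂ I), A I / A x.1 * (f (I, x.2) - f x)

/-- Transition-rate matrix `q^Z` of the unreliable Jackson network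
(between distinct states; the diagonal is set to `0`). -/
def qZ {J : ℕ} (lam : ℝ) (μ : Fin J → ℕ → ℝ)
    (r : Finset (Fin J) → Option (Fin J) → Option (Fin J) → ℝ)
    (A B : Finset (Fin J) → ℝ) (x y : Est J) : ℝ :=
  if x = y then 0
  else
    (if y.1 = x.1 then
        ∑ j ∈ x.1ᶜ,
          ((if y.2 = x.2 + eV (some j) then lam * r x.1 none (some j) else 0)
            + (if y.2 + eV (some j) = x.2 then μ j (x.2 j) * r x.1 (some j) none else 0)
            + ∑ i ∈ x.1ᶜ,
                if i ≠ j ∧ y.2 + eV (some j) = x.2 + eV (some i) then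
                  μ j (x.2 j) * r x.1 (some j) (some i)
                else 0)
      else 0)
    + (if y.2 = x.2 then
        (if y.1 ⊂ x.1 then B x.1 / B y.1 else 0) + (if x.1 ⊂ y.1 then A y.1 / A x.1 else 0)
      else 0)

/-- Extension `η^D` of the traffic solution: `η^D_0 = λ`, `η^D_j = η_j`. -/
def etaE {J : ℕ} (lam : ℝ) (η : Fin J → ℝ) : Option (Fin J) → ℝ := fun o => o.elim lam η

/-- Normalised routing-equilibrium vector `ξ^D`. -/
def xiV {J : ℕ} (lam : ℝ) (η : Fin J → ℝ) (D : Finset (Fin J))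
    (o : Option (Fin J)) : ℝ :=
  etaE lam η o / ∑ k ∈ ext J D, etaE lam η k

/-- Spectral gap of a generator on the network state space w.r.t. a measure `m`. -/
def GapZ {J : ℕ} (m : Est J → ℝ) (Q : (Est J → ℝ) → Est J → ℝ) : ℝ :=
  sInf {v : ℝ | ∃ f : Est J → ℝ,
    Summable (fun x => f x * f x * m x) ∧ (∑' x, f x * m x) = 0 ∧
      (∑' x, f x * f x * m x) = 1 ∧ v = ∑' x, f x * -(Q f x) * m x}

/-- Spectral gap of a generator on `2^{J̃}` w.r.t. a probability vector `m`. -/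
def GapY {J : ℕ} (m : Finset (Fin J) → ℝ)
    (Q : (Finset (Fin J) → ℝ) → Finset (Fin J) → ℝ) : ℝ :=
  sInf {v : ℝ | ∃ f : Finset (Fin J) → ℝ,
    (∑ D, m D * f D) = 0 ∧ (∑ D, m D * f D ^ 2) = 1 ∧
      v = -(∑ D, m D * f D * Q f D)}

/-- Merge a vector indexed by `D` with a vector indexed by `J̃∖D`. -/
def merge {J : ℕ} (D : Finset (Fin J)) (a : {j : Fin J // j ∈ D} → ℕ)
    (b : {j : Fin J // j ∉ D} → ℕ) : Fin J → ℕ := fun j =>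
  if h : j ∈ D then a ⟨j, h⟩ else b ⟨j, h⟩

/-- Marginal product-form density on a sub-collection of nodes. -/
def piSub {J : ℕ} (η : Fin J → ℝ) (μ : Fin J → ℕ → ℝ) (p : Fin J → Prop)
    [DecidablePred p] (a : {j : Fin J // p j} → ℕ) : ℝ :=
  ∏ j : {j : Fin J // p j}, prodK η μ j.1 (a j) / Cnorm η μ j.1

/-- Unit vector on a subtype index set. -/
def eS {J : ℕ} {p : Fin J → Prop} (j : {k : Fin J // p k}) :
    {k : Fin J // p k} → ℕ := fun i => if i = j then 1 else 0

/-- Generator of the synthetic subnetwork on the up nodes `J̃∖D`. -/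
def QXsub {J : ℕ} (lam : ℝ) (μ : Fin J → ℕ → ℝ)
    (r : Finset (Fin J) → Option (Fin J) → Option (Fin J) → ℝ)
    (D : Finset (Fin J)) (h : ({j : Fin J // j ∉ D} → ℕ) → ℝ)
    (m : {j : Fin J // j ∉ D} → ℕ) : ℝ :=
  (∑ j : {j : Fin J // j ∉ D}, lam * r D none (some j.1) * (h (m + eS j) - h m))
    + (∑ j : {j : Fin J // j ∉ D}, μ j.1 (m j) * r D (some j.1) none * (h (m - eS j) - h m))
    + ∑ j : {j : Fin J // j ∉ D}, ∑ i : {j : Fin J // j ∉ D},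
        μ j.1 (m j) * r D (some j.1) (some i.1) * (h (m - eS j + eS i) - h m)

/-- Transition-rate matrix `q^X` of the (reliable) Jackson network. -/
def qX {J : ℕ} (lam : ℝ) (μ : Fin J → ℕ → ℝ)
    (r : Option (Fin J) → Option (Fin J) → ℝ) (n m : Fin J → ℕ) : ℝ :=
  if n = m then 0
  else
    ∑ j : Fin J,
      ((if m = n + eV (some j) then lam * r none (some j) else 0)
        + (if m + eV (some j) = n then μ j (n j) * r (some j) none else 0)
        + ∑ i : Fin J,
            if i ≠ j ∧ m + eV (some j) = n + eV (some i) then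
              μ j (n j) * r (some j) (some i)
            else 0)

/-- One-step Markov operator `K = Id + ε·Q`. -/
def Kop {J : ℕ} (ε : ℝ) (Q : (Est J → ℝ) → Est J → ℝ) :
    (Est J → ℝ) → Est J → ℝ := fun h x => h x + ε * Q h x

theorem eV_other {J : ℕ} (n : Fin J → ℕ) (j i : Fin J) :
    eV (some j) i = if i = j then 1 else 0 := rfl

theorem piX_add {J : ℕ} (η : Fin J → ℝ) (μ : Fin J → ℕ → ℝ) (n : Fin J → ℕ) (j : Fin J) :
    piX η μ (n + eV (some j)) = piX η μ n * (η j / μ j (n j + 1)) := by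
  have h : ∀ i, prodK η μ i ((n + eV (some j)) i) / Cnorm η μ i
      = (prodK η μ i (n i) / Cnorm η μ i) * (if i = j then η j / μ j (n j + 1) else 1) := by
    intro i
    by_cases hij : i = j
    · subst hij
      simp [eV, prodK, Finset.prod_range_succ]
      ring
    · simp [eV, hij]
  unfold piX
  rw [Finset.prod_congr rfl (fun i _ => h i), Finset.prod_mul_distrib]
  simp

theorem piX_nonneg {J : ℕ} (η : Fin J → ℝ) (μ : Fin J → ℕ → ℝ) (hη : ∀ j, 0 < η j)
    (hμpos : ∀ j k, k ≠ 0 → 0 < μ j k) (n : Fin J → ℕ) : 0 ≤ piX η μ n := by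
  have h : ∀ j k, 0 ≤ prodK η μ j k := fun j k =>
    Finset.prod_nonneg (fun i _ => (div_pos (hη j) (hμpos j _ (Nat.succ_ne_zero i))).le)
  exact Finset.prod_nonneg (fun j _ => div_nonneg (h _ _) (tsum_nonneg (h j)))

theorem key {N : Type*} (p F G G' c : N → ℝ) (T : N → N) (S : Set N) (K K' : ℝ)
    (hp : ∀ n, 0 ≤ p n)
    (hF : Summable fun n => F n * F n * p n) (hG : Summable fun n => G n * G n * p n)
    (hG' : Summable fun n => G' n * G' n * p n)
    (hc : ∀ n, |c n| ≤ K) (hS : ∀ n, n ∉ S → c n = 0) (hT : Set.InjOn T S)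
    (hb : ∀ n ∈ S, |c n| * p n ≤ K' * p (T n)) :
    Summable fun n => F n * (c n * (G (T n) - G' n)) * p n := by
  have h1 : Summable (S.indicator fun n => G (T n) * G (T n) * p (T n)) := by
    rw [← summable_subtype_iff_indicator]
    exact hG.comp_injective (i := fun s : S => T s) (fun a b h => Subtype.ext (hT a.2 b.2 h))
  have hb2 := ((hF.mul_left (2 * K)).add (hG'.mul_left K)).add (h1.mul_left K')
  refine Summable.of_norm_bounded hb2 (fun n => ?_)
  have hK : 0 ≤ K := (abs_nonneg _).trans (hc n)
  by_cases hn : n ∈ S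
  · simp only [Set.indicator_of_mem hn]
    have e : ‖F n * (c n * (G (T n) - G' n)) * p n‖ = |c n| * (|F n| * |G (T n) - G' n|) * p n := by
      rw [Real.norm_eq_abs, abs_mul, abs_mul, abs_mul, abs_of_nonneg (hp n)]; ring
    rw [e]
    have a1 : |F n| * |G (T n) - G' n| ≤ 2 * (F n * F n) + G (T n) * G (T n) + G' n * G' n := by
      rw [← abs_mul]
      apply abs_le.2
      constructor <;>
        nlinarith [sq_nonneg (F n + G (T n)), sq_nonneg (F n - G (T n)), sq_nonneg (F n + G' n), sq_nonneg (F n - G' n), sq_nonneg (F n), sq_nonneg (G (T n)), sq_nonneg (G' n)]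
    have a2 := mul_le_mul_of_nonneg_left a1 (mul_nonneg (abs_nonneg (c n)) (hp n))
    have a3 := mul_le_mul_of_nonneg_right (hb n hn) (mul_self_nonneg (G (T n)))
    have a4 := mul_le_mul_of_nonneg_right (hc n)
      (mul_nonneg (add_nonneg (mul_nonneg zero_le_two (mul_self_nonneg (F n))) (mul_self_nonneg (G' n))) (hp n))
    nlinarith
  · simp only [Set.indicator_of_notMem hn, hS n hn]
    have := mul_nonneg (mul_self_nonneg (F n)) (hp n)
    have := mul_nonneg (mul_self_nonneg (G' n)) (hp n)
    simp only [zero_mul, mul_zero, norm_zero, add_zero]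
    positivity

theorem Chat_pos {J : ℕ} (A B : Finset (Fin J) → ℝ) (hA : ∀ D, 0 < A D) (hB : ∀ D, 0 < B D) :
    0 < Chat A B :=
  Finset.sum_pos (fun D _ => div_pos (hA D) (hB D)) Finset.univ_nonempty

theorem summable_fin_prod {α β : Type*} [Fintype α] (F : α × β → ℝ)
    (h : ∀ a, Summable fun b => F (a, b)) : Summable F := by
  refine Summable.of_norm ?_
  rw [summable_prod_of_nonneg (fun _ => norm_nonneg _)]
  exact ⟨fun a => (h a).norm, (hasSum_fintype _).summable⟩

theorem sub_add_eV {J : ℕ} (n : Fin J → ℕ) (j : Fin J) (h : n j ≠ 0) :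
    n - eV (some j) + eV (some j) = n := by
  funext i
  by_cases hij : i = j
  · subst hij; simp [eV]; omega
  · simp [eV, hij]

theorem QZ_summable {J : ℕ} (lam : ℝ)
    (μ : Fin J → ℕ → ℝ)
    (hμ0 : ∀ j, μ j 0 = 0)
    (hμpos : ∀ j k, k ≠ 0 → 0 < μ j k)
    (hμbdd : ∃ M : ℝ, ∀ j k, μ j k ≤ M)
    (r : Finset (Fin J) → Option (Fin J) → Option (Fin J) → ℝ)
    (η : Fin J → ℝ) (hη : ∀ j, 0 < η j)
    (A B A' B' : Finset (Fin J) → ℝ)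
    (hApos : ∀ D, 0 < A D) (hBpos : ∀ D, 0 < B D)
    (f g : Est J → ℝ)
    (hf : Summable (fun x : Est J => f x * f x * piZ η μ A B x))
    (hg : Summable (fun x : Est J => g x * g x * piZ η μ A B x)) :
    Summable fun x : Est J => f x * QZ lam μ r A' B' g x * piZ η μ A B x := by
  obtain ⟨M, hM⟩ := hμbdd
  have fib : ∀ h : Est J → ℝ, Summable (fun x : Est J => h x * h x * piZ η μ A B x) →
      ∀ D, Summable fun n => h (D, n) * h (D, n) * piX η μ n := by
    intro h hh D
    have h1 := hh.comp_injective (i := fun n : Fin J → ℕ => (D, n))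
      (fun a b hab => (Prod.mk.inj hab).2)
    have hpos : piY A B D ≠ 0 :=
      (div_pos (div_pos (hApos D) (hBpos D)) (Chat_pos A B hApos hBpos)).ne'
    refine (h1.mul_left (piY A B D)⁻¹).congr (fun n => ?_)
    simp only [Function.comp, piZ]
    field_simp
  have hp := piX_nonneg η μ hη hμpos
  have hμnn : ∀ j k, 0 ≤ μ j k := by
    intro j k
    rcases eq_or_ne k 0 with rfl | h
    · rw [hμ0]
    · exact (hμpos j k h).le
  have hadd : ∀ n j, piX η μ n = piX η μ (n + eV (some j)) * (μ j (n j + 1) / η j) := by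
    intro n j
    rw [piX_add]
    have := (hμpos j (n j + 1) (Nat.succ_ne_zero _)).ne'
    have := (hη j).ne'
    field_simp
  have hup : ∀ n j, piX η μ n ≤ (M / η j) * piX η μ (n + eV (some j)) := by
    intro n j
    rw [hadd n j, mul_comm]
    exact mul_le_mul_of_nonneg_right (div_le_div_of_nonneg_right (hM _ _) (hη j).le) (hp _)
  have hdown : ∀ n j, n j ≠ 0 → μ j (n j) * piX η μ n = η j * piX η μ (n - eV (some j)) := by
    intro n j hn
    have h1 := hadd (n - eV (some j)) j
    rw [sub_add_eV n j hn] at h1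
    have h2 : (n - eV (some j)) j + 1 = n j := by simp [eV]; omega
    rw [h2] at h1
    rw [h1]
    have := (hη j).ne'
    field_simp
  have hinj : ∀ j, Set.InjOn (fun n : Fin J → ℕ => n - eV (some j)) {n | n j ≠ 0} := by
    intro j a ha b hb hab
    rw [← sub_add_eV a j ha, ← sub_add_eV b j hb]
    exact congrArg (· + eV (some j)) hab
  refine summable_fin_prod _ (fun D => ?_)
  suffices h : Summable fun n => f (D, n) * QZ lam μ r A' B' g (D, n) * piX η μ n by
    refine (h.mul_left (piY A B D)).congr (fun n => ?_)
    simp only [piZ]; ring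
  simp only [QZ, mul_add, add_mul, Finset.mul_sum, Finset.sum_mul]
  have hcb : ∀ j k (t : ℝ), |μ j k * t| ≤ M * |t| := by
    intro j k t
    rw [abs_mul, abs_of_nonneg (hμnn j k)]
    exact mul_le_mul_of_nonneg_right (hM j k) (abs_nonneg _)
  refine ((((?_ : Summable _).add ?_).add ?_).add ?_).add ?_
  · refine summable_sum (fun j _ => ?_)
    refine key (piX η μ) _ (fun n => g (D, n)) (fun n => g (D, n)) (fun _ => lam * r D none (some j))
      (fun n => n + eV (some j)) Set.univ |lam * r D none (some j)|
      (|lam * r D none (some j)| * (M / η j)) hp (fib f hf D) (fib g hg D) (fib g hg D)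
      (fun _ => le_rfl) (fun n h => absurd (Set.mem_univ n) h)
      (fun a _ b _ h => add_right_cancel h) (fun n _ => ?_)
    rw [mul_assoc]
    exact mul_le_mul_of_nonneg_left (hup n j) (abs_nonneg _)
  · refine summable_sum (fun j _ => ?_)
    refine key (piX η μ) _ (fun n => g (D, n)) (fun n => g (D, n))
      (fun n => μ j (n j) * r D (some j) none)
      (fun n => n - eV (some j)) {n | n j ≠ 0} (M * |r D (some j) none|)
      (|r D (some j) none| * η j) hp (fib f hf D) (fib g hg D) (fib g hg D)
      (fun _ => hcb _ _ _) (fun n h => ?_) (hinj j) (fun n hn => ?_)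
    · have : n j = 0 := by simpa using h
      simp [this, hμ0]
    · have := hdown n j hn
      simp only [abs_mul, abs_of_nonneg (hμnn _ _)]
      apply le_of_eq
      linear_combination |r D (some j) none| * this
  · refine summable_sum (fun j _ => summable_sum (fun i _ => ?_))
    refine key (piX η μ) _ (fun n => g (D, n)) (fun n => g (D, n))
      (fun n => μ j (n j) * r D (some j) (some i))
      (fun n => n - eV (some j) + eV (some i)) {n | n j ≠ 0} (M * |r D (some j) (some i)|)
      (|r D (some j) (some i)| * η j * (M / η i)) hp (fib f hf D) (fib g hg D) (fib g hg D)
      (fun _ => hcb _ _ _) (fun n h => ?_)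
      (fun a ha b hb h => hinj j ha hb (add_right_cancel h)) (fun n hn => ?_)
    · have : n j = 0 := by simpa using h
      simp [this, hμ0]
    · have h1 := hdown n j hn
      have h2 := mul_le_mul_of_nonneg_left (hup (n - eV (some j)) i)
        (mul_nonneg (abs_nonneg (r D (some j) (some i))) (hη j).le)
      simp only [abs_mul, abs_of_nonneg (hμnn _ _)]
      rw [mul_assoc _ (M / η i)]
      refine le_trans (le_of_eq ?_) h2
      linear_combination |r D (some j) (some i)| * h1
  · refine summable_sum (fun H _ => ?_)
    exact key (piX η μ) _ (fun n => g (H, n)) (fun n => g (D, n)) (fun _ => B' D / B' H)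
      id Set.univ |B' D / B' H| |B' D / B' H| hp (fib f hf D) (fib g hg H) (fib g hg D)
      (fun _ => le_rfl) (fun n h => absurd (Set.mem_univ n) h)
      (fun a _ b _ h => h) (fun n _ => le_rfl)
  · refine summable_sum (fun H _ => ?_)
    exact key (piX η μ) _ (fun n => g (H, n)) (fun n => g (D, n)) (fun _ => A' H / A' D)
      id Set.univ |A' H / A' D| |A' H / A' D| hp (fib f hf D) (fib g hg H) (fib g hg D)
      (fun _ => le_rfl) (fun n h => absurd (Set.mem_univ n) h)
      (fun a _ b _ h => h) (fun n _ => le_rfl)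

/-- change of breakdown and repair mechanisms.  Two networks share
everything except the breakdown/repair data `(A,B)` vs `(A',B')`, which have the
same stationary distribution `π̂`; the difference of one-step correlations is
governed by `Q^Y − Q^{Y'}`. -/
theorem correlation_difference_breakdown_repair
    (J : ℕ) (hJ : 1 ≤ J)
    (lam : ℝ) (hlam : 0 < lam)
    (μ : Fin J → ℕ → ℝ)
    (hμ0 : ∀ j, μ j 0 = 0)
    (hμpos : ∀ j k, k ≠ 0 → 0 < μ j k)
    (hμbdd : ∃ M : ℝ, ∀ j k, μ j k ≤ M)
    (r : Finset (Fin J) → Option (Fin J) → Option (Fin J) → ℝ)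
    (hrnn : ∀ D : Finset (Fin J), ∀ i ∈ ext J D, ∀ j ∈ ext J D, 0 ≤ r D i j)
    (hrsto : ∀ D : Finset (Fin J), ∀ i ∈ ext J D, ∑ j ∈ ext J D, r D i j = 1)
    (η : Fin J → ℝ) (hη : ∀ j, 0 < η j)
    (htraffic : ∀ D : Finset (Fin J), ∀ j ∈ Dᶜ,
      η j = lam * r D none (some j) + ∑ i ∈ Dᶜ, η i * r D (some i) (some j))
    (A B : Finset (Fin J) → ℝ)
    (hApos : ∀ D, 0 < A D) (hBpos : ∀ D, 0 < B D)
    (hA0 : A (∅ : Finset (Fin J)) = 1) (hB0 : B (∅ : Finset (Fin J)) = 1)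
    (A' B' : Finset (Fin J) → ℝ)
    (hA'pos : ∀ D, 0 < A' D) (hB'pos : ∀ D, 0 < B' D)
    (hA'0 : A' (∅ : Finset (Fin J)) = 1) (hB'0 : B' (∅ : Finset (Fin J)) = 1)
    (hsame : ∀ D : Finset (Fin J), piY A B D = piY A' B' D)
    (hC : ∀ j, Summable (fun k => prodK η μ j k))
    (f g : Est J → ℝ)
    (hf : Summable (fun x : Est J => f x * f x * piZ η μ A B x))
    (hg : Summable (fun x : Est J => g x * g x * piZ η μ A B x)) :
    ((∑' x : Est J, f x * QZ lam μ r A B g x * piZ η μ A B x)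
        - ∑' x : Est J, f x * QZ lam μ r A' B' g x * piZ η μ A B x)
      = ∑' n : Fin J → ℕ, piX η μ n * ∑ D : Finset (Fin J),
          piY A B D * f (D, n)
            * (QY A B (fun E => g (E, n)) D - QY A' B' (fun E => g (E, n)) D) := by
  have s1 := QZ_summable lam μ hμ0 hμpos hμbdd r η hη A B A B hApos hBpos f g hf hg
  have s2 := QZ_summable lam μ hμ0 hμpos hμbdd r η hη A B A' B' hApos hBpos f g hf hg
  have hs := s1.sub s2
  rw [← s1.tsum_sub s2]
  rw [← (Equiv.prodComm _ _).tsum_eq]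
  have hs' := ((Equiv.prodComm (Fin J → ℕ) (Finset (Fin J))).summable_iff).2 hs
  refine hs'.tsum_prod.trans ?_
  refine tsum_congr (fun n => ?_)
  rw [tsum_fintype, Finset.mul_sum]
  refine Finset.sum_congr rfl (fun D _ => ?_)
  have e : QZ lam μ r A B g (D, n) - QZ lam μ r A' B' g (D, n)
      = QY A B (fun E => g (E, n)) D - QY A' B' (fun E => g (E, n)) D := by
    simp only [QZ, QY]
    rw [add_assoc (_ + _ + _), add_assoc (_ + _ + _), add_sub_add_left_eq_sub]
  rw [← e]
  simp only [Function.comp, Equiv.prodComm_apply, Prod.swap, piZ]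
  ring

end UnrelNet
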